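/- Let (H,A) be a compatible weak matched pair. Then A♯♯H is a unital algebra: for all x,y ∈ A and h,g ∈ H one has (x♯♯h)(y♯♯g) = (x(h₁·y))♯♯(h₂g), and 1_A♯♯1_H is a two-sided unit for A♯♯H. -/

import Mathlib

open TensorProduct

noncomputable section

namespace WeakSmash

variable (k : Type*) [Field k]

/-- A weak bialgebra structure on the `k`-algebra `H`. -/
structure WeakBialgebra (H : Type*) [Ring H] [Algebra k H] where
  comul : H →ₗ[k] H ⊗[k] H
  counit : H →ₗ[k] k
  coassoc : ∀ h : H,
    (TensorProduct.assoc k H H H) ((LinearMap.rTensor H comul) (comul h)) =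
      (LinearMap.lTensor H comul) (comul h)
  counit_comul : ∀ h : H,
    (TensorProduct.lid k H) ((LinearMap.rTensor H counit) (comul h)) = h
  comul_counit : ∀ h : H,
    (TensorProduct.rid k H) ((LinearMap.lTensor H counit) (comul h)) = h
  comul_mul : ∀ h g : H, comul (h * g) = comul h * comul g
  counit_weak : ∀ h g l : H,
    counit (h * g * l) =
      LinearMap.mul' k k
        ((TensorProduct.map (counit ∘ₗ LinearMap.mulLeft k h)
            (counit ∘ₗ LinearMap.mulRight k l)) (comul g))
  counit_weak' : ∀ h g l : H,
    counit (h * g * l) =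
      LinearMap.mul' k k
        ((TensorProduct.map (counit ∘ₗ LinearMap.mulLeft k h)
            (counit ∘ₗ LinearMap.mulRight k l)) ((TensorProduct.comm k H H) (comul g)))
  comul_one_left :
    ((TensorProduct.assoc k H H H) (comul 1 ⊗ₜ[k] (1 : H))) * ((1 : H) ⊗ₜ[k] comul 1) =
      (LinearMap.lTensor H comul) (comul 1)
  comul_one_right :
    ((1 : H) ⊗ₜ[k] comul 1) * ((TensorProduct.assoc k H H H) (comul 1 ⊗ₜ[k] (1 : H))) =
      (LinearMap.lTensor H comul) (comul 1)

variable {k}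

namespace WeakBialgebra

variable {H : Type*} [Ring H] [Algebra k H]

/-- The target counital map `εt h = ε(1₁ h) 1₂`. -/
def εt (W : WeakBialgebra k H) : H →ₗ[k] H :=
  (TensorProduct.lid k H).toLinearMap ∘ₗ LinearMap.rTensor H W.counit ∘ₗ
    LinearMap.mulLeft k (W.comul 1) ∘ₗ (TensorProduct.mk k H H).flip 1

/-- The source counital map `εs h = 1₁ ε(h 1₂)`. -/
def εs (W : WeakBialgebra k H) : H →ₗ[k] H :=
  (TensorProduct.rid k H).toLinearMap ∘ₗ LinearMap.lTensor H W.counit ∘ₗ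
    LinearMap.mulRight k (W.comul 1) ∘ₗ TensorProduct.mk k H H 1

/-- Cocommutativity of a weak bialgebra. -/
def Cocomm (W : WeakBialgebra k H) : Prop :=
  ∀ h : H, (TensorProduct.comm k H H) (W.comul h) = W.comul h

/-- `S` is an antipode for `W`, making it a weak Hopf algebra. -/
structure IsAntipode (W : WeakBialgebra k H) (S : H →ₗ[k] H) : Prop where
  mul_antipode : ∀ h : H,
    LinearMap.mul' k H ((LinearMap.lTensor H S) (W.comul h)) = W.εt h
  antipode_mul : ∀ h : H,
    LinearMap.mul' k H ((LinearMap.rTensor H S) (W.comul h)) = W.εs h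
  antipode_mid : ∀ h : H,
    LinearMap.mul' k H
      ((TensorProduct.map S (LinearMap.mul' k H ∘ₗ LinearMap.lTensor H S))
        ((LinearMap.lTensor H W.comul) (W.comul h))) = S h

/-- `α` is a left integral: `h α = εt(h) α`. -/
def IsLeftIntegral (W : WeakBialgebra k H) (α : H) : Prop :=
  ∀ h : H, h * α = W.εt h * α

end WeakBialgebra

section MatchedPair

variable (k)
variable {H A : Type*} [Ring H] [Algebra k H] [Ring A] [Algebra k A]

/-- `A` is a left `H`-module algebra via the action `act`. -/
structure IsModuleAlgebra (WH : WeakBialgebra k H) (act : H →ₗ[k] A →ₗ[k] A) : Prop where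
  one_act : ∀ a : A, act 1 a = a
  act_mul : ∀ (h : H) (a b : A),
    act h (a * b) =
      LinearMap.mul' k A ((TensorProduct.map (act.flip a) (act.flip b)) (WH.comul h))
  act_act : ∀ (h g : H) (a : A), act h (act g a) = act (h * g) a
  act_unit : ∀ h : H, act h 1 = act (WH.εt h) 1

/-- The map `h ↦ ε(h⁰) h¹`. -/
def coactCounit (WH : WeakBialgebra k H) (coact : H →ₗ[k] H ⊗[k] A) : H →ₗ[k] A :=
  (TensorProduct.lid k A).toLinearMap ∘ₗ LinearMap.rTensor A WH.counit ∘ₗ coact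

/-- `H` is a right `A`-comodule coalgebra via the coaction `coact`. -/
structure IsComoduleCoalgebra (WH : WeakBialgebra k H) (WA : WeakBialgebra k A)
    (coact : H →ₗ[k] H ⊗[k] A) : Prop where
  counit_coact : ∀ h : H,
    (TensorProduct.rid k H) ((LinearMap.lTensor H WA.counit) (coact h)) = h
  comul_coact : ∀ h : H,
    (LinearMap.rTensor A WH.comul) (coact h) =
      (LinearMap.lTensor (H ⊗[k] H) (LinearMap.mul' k A))
        ((TensorProduct.tensorTensorTensorComm k H A H A)
          ((TensorProduct.map coact coact) (WH.comul h)))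
  coact_coact : ∀ h : H,
    (TensorProduct.assoc k H A A) ((LinearMap.rTensor A coact) (coact h)) =
      (LinearMap.lTensor H WA.comul) (coact h)
  coact_counit : ∀ h : H,
    coactCounit k WH coact h = WA.εs (coactCounit k WH coact h)

/-- The map `(h₁ ⊗ h₂) ⊗ (x₁ ⊗ x₂) ↦ (h₁⁰ · x₁) ⊗ (h₁¹ (h₂ · x₂))`. -/
def pairMapA (act : H →ₗ[k] A →ₗ[k] A) (coact : H →ₗ[k] H ⊗[k] A) :
    (H ⊗[k] H) ⊗[k] (A ⊗[k] A) →ₗ[k] A ⊗[k] A :=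
  LinearMap.lTensor A (LinearMap.mul' k A) ∘ₗ
  (TensorProduct.assoc k A A A).toLinearMap ∘ₗ
  LinearMap.rTensor A
    (LinearMap.rTensor A (TensorProduct.lift act) ∘ₗ
      (TensorProduct.assoc k H A A).symm.toLinearMap ∘ₗ
      LinearMap.lTensor H (TensorProduct.comm k A A).toLinearMap ∘ₗ
      (TensorProduct.assoc k H A A).toLinearMap) ∘ₗ
  TensorProduct.map (LinearMap.rTensor A coact) (TensorProduct.lift act) ∘ₗ
  (TensorProduct.tensorTensorTensorComm k H H A A).toLinearMap

/-- The map `(h₁ ⊗ h₂) ⊗ (g⁰ ⊗ g¹) ↦ (h₁⁰ g⁰) ⊗ (h₁¹ (h₂ · g¹))`. -/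
def pairMapH (act : H →ₗ[k] A →ₗ[k] A) (coact : H →ₗ[k] H ⊗[k] A) :
    (H ⊗[k] H) ⊗[k] (H ⊗[k] A) →ₗ[k] H ⊗[k] A :=
  LinearMap.lTensor H (LinearMap.mul' k A) ∘ₗ
  (TensorProduct.assoc k H A A).toLinearMap ∘ₗ
  LinearMap.rTensor A
    (LinearMap.rTensor A (LinearMap.mul' k H) ∘ₗ
      (TensorProduct.assoc k H H A).symm.toLinearMap ∘ₗ
      LinearMap.lTensor H (TensorProduct.comm k A H).toLinearMap ∘ₗ
      (TensorProduct.assoc k H A H).toLinearMap) ∘ₗ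
  TensorProduct.map (LinearMap.rTensor H coact) (TensorProduct.lift act) ∘ₗ
  (TensorProduct.tensorTensorTensorComm k H H H A).toLinearMap

/-- The iterated comultiplication `h ↦ h₁ ⊗ (h₂ ⊗ h₃)`. -/
def twoComul (WH : WeakBialgebra k H) : H →ₗ[k] H ⊗[k] (H ⊗[k] H) :=
  LinearMap.lTensor H WH.comul ∘ₗ WH.comul

/-- The iterated comultiplication `h ↦ h₁ ⊗ (h₂ ⊗ (h₃ ⊗ h₄))`. -/
def threeComul (WH : WeakBialgebra k H) : H →ₗ[k] H ⊗[k] (H ⊗[k] (H ⊗[k] H)) :=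
  LinearMap.lTensor H (LinearMap.lTensor H WH.comul) ∘ₗ LinearMap.lTensor H WH.comul ∘ₗ WH.comul

/-- Left-hand side of the matched pair condition (iii):
`(h₁·x)₁ ⊗ (h₂ g)⁰ ⊗ (h₁·x)₂ (h₂ g)¹`. -/
def mpLHS (WH : WeakBialgebra k H) (WA : WeakBialgebra k A)
    (act : H →ₗ[k] A →ₗ[k] A) (coact : H →ₗ[k] H ⊗[k] A) (h g : H) (x : A) :
    (A ⊗[k] H) ⊗[k] A :=
  LinearMap.lTensor (A ⊗[k] H) (LinearMap.mul' k A)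
    ((TensorProduct.tensorTensorTensorComm k A A H A)
      ((TensorProduct.map (WA.comul ∘ₗ act.flip x) (coact ∘ₗ LinearMap.mulRight k g))
        (WH.comul h)))

/-- Right-hand side of the matched pair condition (iii):
`(h₁⁰ · x₁) ⊗ (h₃⁰ g⁰) ⊗ (h₁¹ (h₂ · x₂) h₃¹ (h₄ · g¹))`. -/
def mpRHS (WH : WeakBialgebra k H) (WA : WeakBialgebra k A)
    (act : H →ₗ[k] A →ₗ[k] A) (coact : H →ₗ[k] H ⊗[k] A) (h g : H) (x : A) :
    (A ⊗[k] H) ⊗[k] A :=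
  LinearMap.lTensor (A ⊗[k] H) (LinearMap.mul' k A)
    ((TensorProduct.tensorTensorTensorComm k A A H A)
      ((TensorProduct.map
          (pairMapA k act coact ∘ₗ
            (TensorProduct.mk k (H ⊗[k] H) (A ⊗[k] A)).flip (WA.comul x))
          (pairMapH k act coact ∘ₗ
            (TensorProduct.mk k (H ⊗[k] H) (H ⊗[k] A)).flip (coact g)))
        ((TensorProduct.assoc k H H (H ⊗[k] H)).symm (threeComul k WH h))))

/-- `(H, A)` is a weak matched pair. -/
structure IsWeakMatchedPair (WH : WeakBialgebra k H) (WA : WeakBialgebra k A)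
    (act : H →ₗ[k] A →ₗ[k] A) (coact : H →ₗ[k] H ⊗[k] A) : Prop where
  moduleAlgebra : IsModuleAlgebra k WH act
  comoduleCoalgebra : IsComoduleCoalgebra k WH WA coact
  cond3 : ∀ (h g : H) (x : A),
    mpLHS k WH WA act coact h g x = mpRHS k WH WA act coact h g x
  cond4 : ∀ (h : H) (x : A), WA.εs (act h x) = WA.εs (act h 1) * WA.εs x
  cond5 :
    (LinearMap.rTensor H coact) (WH.comul 1) =
      (TensorProduct.map (LinearMap.lTensor H (coactCounit k WH coact))
          (LinearMap.mul' k H))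
        ((TensorProduct.tensorTensorTensorComm k H H H H)
          (WH.comul 1 ⊗ₜ[k] WH.comul 1))

/-- `(H, A)` is a compatible (abelian) weak matched pair. -/
structure IsCompatiblePair (WH : WeakBialgebra k H) (WA : WeakBialgebra k A)
    (act : H →ₗ[k] A →ₗ[k] A) (coact : H →ₗ[k] H ⊗[k] A) : Prop where
  pair : IsWeakMatchedPair k WH WA act coact
  cocomm : WH.Cocomm
  comm : ∀ a b : A, a * b = b * a
  compat1 : ∀ h : H,
    act h 1 =
      (TensorProduct.rid k A)
        ((TensorProduct.map (TensorProduct.lift act)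
            (WA.counit ∘ₗ TensorProduct.lift act))
          ((TensorProduct.tensorTensorTensorComm k H H A A)
            (WH.comul h ⊗ₜ[k] WA.comul 1)))
  compat2 : ∀ h g : H,
    (TensorProduct.map (act h) (act g)) (WA.comul 1) =
      (TensorProduct.map (LinearMap.mulLeft k (act h 1))
        (LinearMap.mulLeft k (act g 1))) (WA.comul 1)

/-- The smash product multiplication on `A ⊗ H`:
`(x ⊗ h) (y ⊗ g) = x (h₁ · y) ⊗ h₂ g`. -/
def smashMul (WH : WeakBialgebra k H) (act : H →ₗ[k] A →ₗ[k] A) :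
    (A ⊗[k] H) ⊗[k] (A ⊗[k] H) →ₗ[k] A ⊗[k] H :=
  LinearMap.rTensor H (LinearMap.mul' k A) ∘ₗ
  (TensorProduct.assoc k A A H).symm.toLinearMap ∘ₗ
  LinearMap.lTensor A
    (TensorProduct.map (TensorProduct.lift act) (LinearMap.mul' k H) ∘ₗ
      (TensorProduct.tensorTensorTensorComm k H H A H).toLinearMap) ∘ₗ
  (TensorProduct.assoc k A (H ⊗[k] H) (A ⊗[k] H)).toLinearMap ∘ₗ
  LinearMap.rTensor (A ⊗[k] H) (LinearMap.lTensor A WH.comul)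

/-- The smash coproduct on `A ⊗ H`:
`Δ(x ⊗ h) = (x₁ ⊗ h₁⁰) ⊗ (x₂ h₁¹ ⊗ h₂)`. -/
def smashComul (WH : WeakBialgebra k H) (WA : WeakBialgebra k A)
    (coact : H →ₗ[k] H ⊗[k] A) :
    A ⊗[k] H →ₗ[k] (A ⊗[k] H) ⊗[k] (A ⊗[k] H) :=
  (TensorProduct.assoc k (A ⊗[k] H) A H).toLinearMap ∘ₗ
  LinearMap.rTensor H (LinearMap.lTensor (A ⊗[k] H) (LinearMap.mul' k A)) ∘ₗ
  LinearMap.rTensor H (TensorProduct.tensorTensorTensorComm k A A H A).toLinearMap ∘ₗ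
  (TensorProduct.assoc k (A ⊗[k] A) (H ⊗[k] A) H).symm.toLinearMap ∘ₗ
  LinearMap.lTensor (A ⊗[k] A) (LinearMap.rTensor H coact) ∘ₗ
  TensorProduct.map WA.comul WH.comul

/-- The smash counit `ε(x ⊗ h) = ε(x) ε(h)`. -/
def smashCounit (WH : WeakBialgebra k H) (WA : WeakBialgebra k A) :
    A ⊗[k] H →ₗ[k] k :=
  LinearMap.mul' k k ∘ₗ TensorProduct.map WA.counit WH.counit

/-- The projection `u ↦ u (1_A # 1_H)` onto `A ♯ H`. -/
def projUnder (WH : WeakBialgebra k H) (act : H →ₗ[k] A →ₗ[k] A) :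
    A ⊗[k] H →ₗ[k] A ⊗[k] H :=
  smashMul k WH act ∘ₗ
    (TensorProduct.mk k (A ⊗[k] H) (A ⊗[k] H)).flip ((1 : A) ⊗ₜ[k] (1 : H))

/-- The projection `u ↦ (id ⊗ ε) Δ(u)` onto `overline(A # H)`. -/
def projBar (WH : WeakBialgebra k H) (WA : WeakBialgebra k A)
    (coact : H →ₗ[k] H ⊗[k] A) : A ⊗[k] H →ₗ[k] A ⊗[k] H :=
  (TensorProduct.rid k (A ⊗[k] H)).toLinearMap ∘ₗ
    LinearMap.lTensor (A ⊗[k] H) (smashCounit k WH WA) ∘ₗ smashComul k WH WA coact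

/-- The projection onto `A ♯♯ H`, i.e. `u ↦ (id ⊗ ε) Δ (u (1#1))`. -/
def projBoth (WH : WeakBialgebra k H) (WA : WeakBialgebra k A)
    (act : H →ₗ[k] A →ₗ[k] A) (coact : H →ₗ[k] H ⊗[k] A) :
    A ⊗[k] H →ₗ[k] A ⊗[k] H :=
  projBar k WH WA coact ∘ₗ projUnder k WH act

/-- Componentwise smash multiplication on `(A⊗H) ⊗ (A⊗H)`. -/
def smashMul2 (WH : WeakBialgebra k H) (act : H →ₗ[k] A →ₗ[k] A) :
    ((A ⊗[k] H) ⊗[k] (A ⊗[k] H)) ⊗[k] ((A ⊗[k] H) ⊗[k] (A ⊗[k] H)) →ₗ[k]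
      (A ⊗[k] H) ⊗[k] (A ⊗[k] H) :=
  TensorProduct.map (smashMul k WH act) (smashMul k WH act) ∘ₗ
    (TensorProduct.tensorTensorTensorComm k (A ⊗[k] H) (A ⊗[k] H)
      (A ⊗[k] H) (A ⊗[k] H)).toLinearMap

/-- Componentwise smash multiplication on threefold tensors. -/
def smashMul3 (WH : WeakBialgebra k H) (act : H →ₗ[k] A →ₗ[k] A) :
    ((A ⊗[k] H) ⊗[k] ((A ⊗[k] H) ⊗[k] (A ⊗[k] H))) ⊗[k]
      ((A ⊗[k] H) ⊗[k] ((A ⊗[k] H) ⊗[k] (A ⊗[k] H))) →ₗ[k]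
      (A ⊗[k] H) ⊗[k] ((A ⊗[k] H) ⊗[k] (A ⊗[k] H)) :=
  TensorProduct.map (smashMul k WH act) (smashMul2 k WH act) ∘ₗ
    (TensorProduct.tensorTensorTensorComm k (A ⊗[k] H)
      ((A ⊗[k] H) ⊗[k] (A ⊗[k] H)) (A ⊗[k] H)
      ((A ⊗[k] H) ⊗[k] (A ⊗[k] H))).toLinearMap

/-- The unit element `1_A ♯♯ 1_H` of `A ♯♯ H`. -/
def smashOne (WH : WeakBialgebra k H) (WA : WeakBialgebra k A)
    (act : H →ₗ[k] A →ₗ[k] A) (coact : H →ₗ[k] H ⊗[k] A) : A ⊗[k] H :=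
  projBoth k WH WA act coact ((1 : A) ⊗ₜ[k] (1 : H))

/-- The map `εt` of the weak bialgebra `A ♯♯ H`: `u ↦ ε(e₁ u) e₂` where `e = 1_A ♯♯ 1_H`. -/
def smashEpsT (WH : WeakBialgebra k H) (WA : WeakBialgebra k A)
    (act : H →ₗ[k] A →ₗ[k] A) (coact : H →ₗ[k] H ⊗[k] A) (u : A ⊗[k] H) :
    A ⊗[k] H :=
  (TensorProduct.lid k (A ⊗[k] H))
    ((LinearMap.rTensor (A ⊗[k] H)
        (smashCounit k WH WA ∘ₗ smashMul k WH act ∘ₗ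
          (TensorProduct.mk k (A ⊗[k] H) (A ⊗[k] H)).flip u))
      (smashComul k WH WA coact (smashOne k WH WA act coact)))

/-- The map `εs` of the weak bialgebra `A ♯♯ H`: `u ↦ e₁ ε(u e₂)` where `e = 1_A ♯♯ 1_H`. -/
def smashEpsS (WH : WeakBialgebra k H) (WA : WeakBialgebra k A)
    (act : H →ₗ[k] A →ₗ[k] A) (coact : H →ₗ[k] H ⊗[k] A) (u : A ⊗[k] H) :
    A ⊗[k] H :=
  (TensorProduct.rid k (A ⊗[k] H))
    ((LinearMap.lTensor (A ⊗[k] H)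
        (smashCounit k WH WA ∘ₗ smashMul k WH act ∘ₗ
          TensorProduct.mk k (A ⊗[k] H) (A ⊗[k] H) u))
      (smashComul k WH WA coact (smashOne k WH WA act coact)))

/-- The antipode of `A ♯♯ H`:
`S(x ⊗ h) = (1_A ♯♯ S_H(h⁰)) ((S_A(x h¹)) ♯♯ 1_H)`. -/
def smashAntipode (WH : WeakBialgebra k H) (WA : WeakBialgebra k A)
    (act : H →ₗ[k] A →ₗ[k] A) (coact : H →ₗ[k] H ⊗[k] A)
    (SH : H →ₗ[k] H) (SA : A →ₗ[k] A) : A ⊗[k] H →ₗ[k] A ⊗[k] H :=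
  smashMul k WH act ∘ₗ
  TensorProduct.map
    (projBoth k WH WA act coact ∘ₗ TensorProduct.mk k A H 1)
    (projBoth k WH WA act coact ∘ₗ (TensorProduct.mk k A H).flip 1) ∘ₗ
  (TensorProduct.comm k A H).toLinearMap ∘ₗ
  TensorProduct.map (SA ∘ₗ LinearMap.mul' k A) SH ∘ₗ
  (TensorProduct.assoc k A A H).symm.toLinearMap ∘ₗ
  LinearMap.lTensor A ((TensorProduct.comm k H A).toLinearMap ∘ₗ coact)

/-- LHS of condition (7): `(1_{H1} h⁰ · 1_A) ⊗ S_A(h¹) εs(1_{H2}¹) ⊗ 1_{H2}⁰`. -/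
def cond7LHS (WH : WeakBialgebra k H) (WA : WeakBialgebra k A)
    (act : H →ₗ[k] A →ₗ[k] A) (coact : H →ₗ[k] H ⊗[k] A)
    (SA : A →ₗ[k] A) (h : H) : (A ⊗[k] A) ⊗[k] H :=
  (TensorProduct.assoc k A A H).symm
    ((TensorProduct.map
        (act.flip 1 ∘ₗ LinearMap.mul' k H)
        ((TensorProduct.comm k H A).toLinearMap ∘ₗ
          LinearMap.lTensor H
            (LinearMap.mul' k A ∘ₗ TensorProduct.map SA WA.εs ∘ₗ
              (TensorProduct.comm k A A).toLinearMap) ∘ₗ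
          (TensorProduct.assoc k H A A).toLinearMap ∘ₗ
          LinearMap.rTensor A coact))
      ((TensorProduct.tensorTensorTensorComm k H H H A)
        (WH.comul 1 ⊗ₜ[k] coact h)))

/-- RHS of condition (7):
`εt(1_{H1}⁰ h⁰ · 1_A) ⊗ εt(h¹) εs(1_{H2}¹) 1_{H1}¹ ⊗ 1_{H2}⁰`. -/
def cond7RHS (WH : WeakBialgebra k H) (WA : WeakBialgebra k A)
    (act : H →ₗ[k] A →ₗ[k] A) (coact : H →ₗ[k] H ⊗[k] A) (h : H) :
    (A ⊗[k] A) ⊗[k] H :=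
  (TensorProduct.assoc k A A H).symm
   ((LinearMap.lTensor A (TensorProduct.comm k H A).toLinearMap)
    ((TensorProduct.assoc k A H A)
     ((LinearMap.lTensor (A ⊗[k] H)
        (LinearMap.mul' k A ∘ₗ (TensorProduct.comm k A A).toLinearMap))
      ((TensorProduct.tensorTensorTensorComm k A A H A)
       ((LinearMap.lTensor (A ⊗[k] A) (TensorProduct.comm k A H).toLinearMap)
        ((TensorProduct.map
            (LinearMap.rTensor A (WA.εt ∘ₗ act.flip 1 ∘ₗ LinearMap.mul' k H) ∘ₗ
              (TensorProduct.assoc k H H A).symm.toLinearMap ∘ₗ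
              LinearMap.lTensor H (TensorProduct.comm k A H).toLinearMap ∘ₗ
              (TensorProduct.assoc k H A H).toLinearMap)
            (LinearMap.rTensor H
                (LinearMap.mul' k A ∘ₗ (TensorProduct.comm k A A).toLinearMap ∘ₗ
                  TensorProduct.map WA.εs WA.εt) ∘ₗ
              (TensorProduct.assoc k A A H).symm.toLinearMap ∘ₗ
              LinearMap.lTensor A (TensorProduct.comm k H A).toLinearMap ∘ₗ
              (TensorProduct.assoc k A H A).toLinearMap ∘ₗ
              LinearMap.rTensor A (TensorProduct.comm k H A).toLinearMap))
          ((TensorProduct.tensorTensorTensorComm k (H ⊗[k] A) (H ⊗[k] A) H A)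
            (((TensorProduct.map coact coact) (WH.comul 1)) ⊗ₜ[k] coact h))))))))

/-- LHS of condition (8):
`εs(h₁¹ h₂¹) (S_H(h₁⁰) · 1_A) ⊗ S_H(h₂⁰) h₃`. -/
def cond8LHS (WH : WeakBialgebra k H) (WA : WeakBialgebra k A)
    (act : H →ₗ[k] A →ₗ[k] A) (coact : H →ₗ[k] H ⊗[k] A)
    (SH : H →ₗ[k] H) (h : H) : A ⊗[k] H :=
  LinearMap.rTensor H (LinearMap.mul' k A)
   ((TensorProduct.assoc k A A H).symm
    ((TensorProduct.map
        (WA.εs ∘ₗ LinearMap.mul' k A)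
        (TensorProduct.map (act.flip 1 ∘ₗ SH)
          (LinearMap.mul' k H ∘ₗ LinearMap.rTensor H SH)))
      ((TensorProduct.tensorTensorTensorComm k A H A (H ⊗[k] H))
        ((TensorProduct.map (TensorProduct.comm k H A).toLinearMap
            ((TensorProduct.assoc k A H H).toLinearMap ∘ₗ
              LinearMap.rTensor H (TensorProduct.comm k H A).toLinearMap))
          ((TensorProduct.map coact (LinearMap.rTensor H coact))
            (twoComul k WH h))))))

/-- RHS of condition (8):
`εs(h¹ 1_{H2}¹) εs(h⁰ 1_{H1} · 1_A) ⊗ 1_{H2}⁰`. -/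
def cond8RHS (WH : WeakBialgebra k H) (WA : WeakBialgebra k A)
    (act : H →ₗ[k] A →ₗ[k] A) (coact : H →ₗ[k] H ⊗[k] A) (h : H) :
    A ⊗[k] H :=
  LinearMap.rTensor H (LinearMap.mul' k A ∘ₗ (TensorProduct.comm k A A).toLinearMap)
   ((TensorProduct.assoc k A A H).symm
    ((TensorProduct.map
        (WA.εs ∘ₗ act.flip 1 ∘ₗ LinearMap.mul' k H)
        (LinearMap.rTensor H (WA.εs ∘ₗ LinearMap.mul' k A) ∘ₗ
          (TensorProduct.assoc k A A H).symm.toLinearMap ∘ₗ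
          LinearMap.lTensor A (TensorProduct.comm k H A).toLinearMap))
      ((TensorProduct.tensorTensorTensorComm k H A H (H ⊗[k] A))
        (coact h ⊗ₜ[k] (LinearMap.lTensor H coact) (WH.comul 1)))))

/-- The element `εs(t₁¹ (t₂ · 1_A)) ⊗ t₁⁰` of `A ⊗ H`. -/
def integralWitness (WH : WeakBialgebra k H) (WA : WeakBialgebra k A)
    (act : H →ₗ[k] A →ₗ[k] A) (coact : H →ₗ[k] H ⊗[k] A) (t : H) :
    A ⊗[k] H :=
  (TensorProduct.comm k H A)
    ((LinearMap.lTensor H (WA.εs ∘ₗ LinearMap.mul' k A))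
      ((TensorProduct.assoc k H A A)
        ((LinearMap.rTensor A coact)
          ((LinearMap.lTensor H (act.flip 1)) (WH.comul t)))))

end MatchedPair

end WeakSmash

namespace WeakSmash

namespace WeakBialgebra

variable {k H : Type*} [Field k] [Ring H] [Algebra k H] (W : WeakBialgebra k H)

/-- The contraction `a ⊗ b ↦ a ε(y b)`. -/
def contract (y : H) : H ⊗[k] H →ₗ[k] H :=
  (TensorProduct.rid k H).toLinearMap ∘ₗ
    LinearMap.lTensor H (W.counit ∘ₗ LinearMap.mulLeft k y)

@[simp]
theorem contract_tmul (y a b : H) : W.contract y (a ⊗ₜ b) = W.counit (y * b) • a := by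
  simp [contract]

theorem εs_eq_contract (y : H) : W.εs y = W.contract y (W.comul 1) := by
  have key : ∀ t : H ⊗[k] H, TensorProduct.rid k H (LinearMap.lTensor H W.counit
      (((1 : H) ⊗ₜ[k] y) * t)) = W.contract y t := fun t ↦ by
    induction t using TensorProduct.induction_on with
    | zero => simp
    | tmul a b => simp
    | add s t hs ht => simp only [mul_add, map_add, hs, ht]
  exact key _

theorem contract_one_comul (x : H) : W.contract 1 (W.comul x) = x := by
  have h : W.contract 1 = (TensorProduct.rid k H).toLinearMap ∘ₗ
      LinearMap.lTensor H W.counit := TensorProduct.ext' fun a b ↦ by simp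
  rw [h]
  exact W.comul_counit x

theorem comul_εs (y : H) : W.comul (W.εs y) = ((1 : H) ⊗ₜ[k] W.εs y) * W.comul 1 := by
  have h₁ : ∀ t : H ⊗[k] H, LinearMap.lTensor H (W.contract y)
      (TensorProduct.assoc k H H H (LinearMap.rTensor H W.comul t)) =
        W.comul (W.contract y t) := fun t ↦ by
    induction t using TensorProduct.induction_on with
    | zero => simp
    | tmul a b =>
      simp only [LinearMap.rTensor_tmul, contract_tmul, map_smul]
      generalize W.comul a = s
      induction s using TensorProduct.induction_on with
      | zero => simp
      | tmul c d => simp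
      | add s t hs ht => simp only [TensorProduct.add_tmul, map_add, hs, ht, smul_add]
    | add s t hs ht => simp only [map_add, hs, ht]
  have h₂ : ∀ s t : H ⊗[k] H, LinearMap.lTensor H (W.contract y)
      (((1 : H) ⊗ₜ[k] s) * TensorProduct.assoc k H H H (t ⊗ₜ[k] (1 : H))) =
        ((1 : H) ⊗ₜ[k] W.contract y s) * t := fun s t ↦ by
    induction t using TensorProduct.induction_on with
    | zero => simp
    | tmul a b =>
      induction s using TensorProduct.induction_on with
      | zero => simp
      | tmul c d => simp
      | add s t hs ht => simp only [TensorProduct.tmul_add, add_mul, map_add, hs, ht]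
    | add t u ht hu => simp only [TensorProduct.add_tmul, mul_add, map_add, ht, hu]
  rw [εs_eq_contract, ← h₁, W.coassoc, ← W.comul_one_right, h₂]

section Commutative

variable {W}

theorem counit_mul_εs (hc : ∀ a b : H, a * b = b * a) (u y : H) :
    W.counit (u * W.εs y) = W.counit (u * y) := by
  have key : ∀ t : H ⊗[k] H, W.counit (u * W.contract y t) =
      LinearMap.mul' k k (TensorProduct.map (W.counit ∘ₗ LinearMap.mulLeft k u)
        (W.counit ∘ₗ LinearMap.mulRight k y) t) := fun t ↦ by
    induction t using TensorProduct.induction_on with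
    | zero => simp
    | tmul a b => simp [hc b y, mul_comm]
    | add s t hs ht => simp only [mul_add, map_add, hs, ht]
  rw [εs_eq_contract, key, ← W.counit_weak, mul_one]

theorem contract_comul (hc : ∀ a b : H, a * b = b * a) (x y : H) :
    W.contract y (W.comul x) = x * W.εs y := by
  have comm_right : ∀ (z : H) (t : H ⊗[k] H),
      ((1 : H) ⊗ₜ[k] z) * t = t * ((1 : H) ⊗ₜ[k] z) := fun z t ↦ by
    induction t using TensorProduct.induction_on with
    | zero => simp
    | tmul a b => simp [hc b z]
    | add s t hs ht => simp only [mul_add, add_mul, hs, ht]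
  have contract_mul : ∀ t : H ⊗[k] H,
      W.contract 1 (t * ((1 : H) ⊗ₜ[k] W.εs y)) = W.contract y t := fun t ↦ by
    induction t using TensorProduct.induction_on with
    | zero => simp
    | tmul a b => simp [counit_mul_εs hc, hc b y]
    | add s t hs ht => simp only [add_mul, map_add, hs, ht]
  rw [← W.contract_one_comul (x * W.εs y), W.comul_mul, comul_εs, comm_right, ← mul_assoc,
    ← W.comul_mul, mul_one, contract_mul]

theorem εs_mul (hc : ∀ a b : H, a * b = b * a) (x y : H) :
    W.εs (x * y) = W.εs x * W.εs y := by
  have key : ∀ t : H ⊗[k] H,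
      W.contract y (((1 : H) ⊗ₜ[k] W.εs x) * t) = W.contract (x * y) t := fun t ↦ by
    induction t using TensorProduct.induction_on with
    | zero => simp
    | tmul a b =>
      simp only [Algebra.TensorProduct.tmul_mul_tmul, one_mul, contract_tmul]
      rw [hc (W.εs x), ← mul_assoc, counit_mul_εs hc, hc _ x, mul_assoc]
    | add s t hs ht => simp only [mul_add, map_add, hs, ht]
  rw [← contract_comul hc (W.εs x), comul_εs, key, εs_eq_contract]

end Commutative

theorem mul_εs_comul (x : H) :
    LinearMap.mul' k H (LinearMap.lTensor H W.εs (W.comul x)) = x := by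
  have key : ∀ t : H ⊗[k] H,
      W.contract 1 (t * W.comul 1) = LinearMap.mul' k H (LinearMap.lTensor H W.εs t) :=
    fun t ↦ by
    induction t using TensorProduct.induction_on with
    | zero => simp
    | tmul a b =>
      have : ∀ u : H ⊗[k] H, W.contract 1 ((a ⊗ₜ b) * u) = a * W.contract b u := fun u ↦ by
        induction u using TensorProduct.induction_on with
        | zero => simp
        | tmul c d => simp
        | add s t hs ht => simp only [mul_add, map_add, hs, ht]
      rw [this, ← εs_eq_contract]
      simp
    | add s t hs ht => simp only [add_mul, map_add, hs, ht]
  rw [← key, ← W.comul_mul, mul_one, contract_one_comul]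

section Convolution

variable {R : Type*} [Ring R] [Algebra k R]

/-- The convolution product `h ↦ f(h₁) g(h₂)`. -/
def conv (f g : H →ₗ[k] R) : H →ₗ[k] R :=
  LinearMap.mul' k R ∘ₗ TensorProduct.map f g ∘ₗ W.comul

theorem conv_apply (f g : H →ₗ[k] R) (h : H) :
    W.conv f g h = LinearMap.mul' k R (TensorProduct.map f g (W.comul h)) := rfl

theorem conv_assoc (f g e : H →ₗ[k] R) :
    W.conv (W.conv f g) e = W.conv f (W.conv g e) := by
  ext x
  let Ψ : H ⊗[k] (H ⊗[k] H) →ₗ[k] R :=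
    LinearMap.mul' k R ∘ₗ TensorProduct.map f (LinearMap.mul' k R ∘ₗ TensorProduct.map g e)
  have h₁ : ∀ t : H ⊗[k] H, LinearMap.mul' k R (TensorProduct.map (W.conv f g) e t) =
      Ψ (TensorProduct.assoc k H H H (LinearMap.rTensor H W.comul t)) := fun t ↦ by
    induction t using TensorProduct.induction_on with
    | zero => simp
    | tmul a b =>
      simp only [TensorProduct.map_tmul, LinearMap.rTensor_tmul, LinearMap.mul'_apply, conv_apply]
      generalize W.comul a = s
      induction s using TensorProduct.induction_on with
      | zero => simp
      | tmul c d => simp [Ψ, mul_assoc]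
      | add s t hs ht => simp only [TensorProduct.add_tmul, map_add, add_mul, hs, ht]
    | add s t hs ht => simp only [map_add, hs, ht]
  have h₂ : ∀ t : H ⊗[k] H, LinearMap.mul' k R (TensorProduct.map f (W.conv g e) t) =
      Ψ (LinearMap.lTensor H W.comul t) := fun t ↦ by
    induction t using TensorProduct.induction_on with
    | zero => simp
    | tmul a b => simp [Ψ, conv_apply]
    | add s t hs ht => simp only [map_add, hs, ht]
  rw [conv_apply, h₁, W.coassoc, ← h₂, ← conv_apply]

variable {W} in
theorem conv_comm (hW : W.Cocomm) {f g : H →ₗ[k] R} (hfg : ∀ a b, f a * g b = g b * f a) :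
    W.conv f g = W.conv g f := by
  ext x
  have key : ∀ t : H ⊗[k] H, LinearMap.mul' k R (TensorProduct.map f g t) =
      LinearMap.mul' k R (TensorProduct.map g f (TensorProduct.comm k H H t)) := fun t ↦ by
    induction t using TensorProduct.induction_on with
    | zero => simp
    | tmul a b => simp [hfg]
    | add s t hs ht => simp only [map_add, hs, ht]
  rw [conv_apply, key, hW, ← conv_apply]

theorem conv_mulRight (f g : H →ₗ[k] R) (r : R) :
    W.conv f (LinearMap.mulRight k r ∘ₗ g) = LinearMap.mulRight k r ∘ₗ W.conv f g := by
  ext x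
  simp only [conv_apply, LinearMap.comp_apply]
  generalize W.comul x = t
  induction t using TensorProduct.induction_on with
  | zero => simp
  | tmul a b => simp [mul_assoc]
  | add s t hs ht => simp only [map_add, hs, ht]

/-- A multiplicative linear map pushes forward convolution. -/
theorem comp_conv {S : Type*} [Ring S] [Algebra k S] (φ : R →ₗ[k] S)
    (hφ : ∀ a b, φ (a * b) = φ a * φ b) (f g : H →ₗ[k] R) :
    φ ∘ₗ W.conv f g = W.conv (φ ∘ₗ f) (φ ∘ₗ g) := by
  ext x
  simp only [conv_apply, LinearMap.comp_apply]
  generalize W.comul x = t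
  induction t using TensorProduct.induction_on with
  | zero => simp
  | tmul a b => simp [hφ]
  | add s t hs ht => simp only [map_add, hs, ht]

end Convolution

end WeakBialgebra

end WeakSmash

namespace WeakSmash

variable {k A H : Type*} [Field k] [Ring H] [Algebra k H] [Ring A] [Algebra k A]

variable (k A H) in
/-- The inclusion `a ↦ a ⊗ 1`. -/
abbrev inclA : A →ₗ[k] A ⊗[k] H := (TensorProduct.mk k A H).flip 1

variable (k A H) in
/-- The inclusion `h ↦ 1 ⊗ h`. -/
abbrev inclH : H →ₗ[k] A ⊗[k] H := TensorProduct.mk k A H 1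

/-- The map `h ↦ εs(h¹) ⊗ h⁰`. -/
def twist (WA : WeakBialgebra k A) (coact : H →ₗ[k] H ⊗[k] A) : H →ₗ[k] A ⊗[k] H :=
  (TensorProduct.comm k H A).toLinearMap ∘ₗ LinearMap.lTensor H WA.εs ∘ₗ coact

/-- The map `h ↦ (h⁰ · w) εs(h¹)`. -/
def twistAct (WA : WeakBialgebra k A) (act : H →ₗ[k] A →ₗ[k] A)
    (coact : H →ₗ[k] H ⊗[k] A) (w : A) : H →ₗ[k] A :=
  LinearMap.mul' k A ∘ₗ TensorProduct.map (act.flip w) WA.εs ∘ₗ coact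

variable {WH : WeakBialgebra k H} {WA : WeakBialgebra k A}
  {act : H →ₗ[k] A →ₗ[k] A} {coact : H →ₗ[k] H ⊗[k] A}

theorem inclA_mul (a b : A) : inclA k A H (a * b) = inclA k A H a * inclA k A H b := by simp

theorem inclA_mul_comm (hc : ∀ a b : A, a * b = b * a) (a : A) (r : A ⊗[k] H) :
    inclA k A H a * r = r * inclA k A H a := by
  induction r using TensorProduct.induction_on with
  | zero => simp
  | tmul b h => simp [hc a b]
  | add s t hs ht => simp only [mul_add, add_mul, hs, ht]

theorem conv_inclA_inclH (f : H →ₗ[k] A) (h : H) :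
    WH.conv (inclA k A H ∘ₗ f) (inclH k A H) h = LinearMap.rTensor H f (WH.comul h) := by
  rw [WeakBialgebra.conv_apply]
  generalize WH.comul h = t
  induction t using TensorProduct.induction_on with
  | zero => simp
  | tmul a b => simp
  | add s t hs ht => simp only [map_add, hs, ht]

theorem conv_inclA_conv (f g : H →ₗ[k] A) (F : H →ₗ[k] A ⊗[k] H) :
    WH.conv (inclA k A H ∘ₗ f) (WH.conv (inclA k A H ∘ₗ g) F) =
      WH.conv (inclA k A H ∘ₗ WH.conv f g) F := by
  rw [WeakBialgebra.comp_conv _ _ inclA_mul, WeakBialgebra.conv_assoc]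

theorem smashMul_tmul (x y : A) (h g : H) :
    smashMul k WH act ((x ⊗ₜ h) ⊗ₜ (y ⊗ₜ g)) =
      inclA k A H x *
        (WH.conv (inclA k A H ∘ₗ act.flip y) (inclH k A H) h * inclH k A H g) := by
  have key : LinearMap.rTensor H (LinearMap.mul' k A) ∘ₗ
        (TensorProduct.assoc k A A H).symm.toLinearMap ∘ₗ
        LinearMap.lTensor A
          (TensorProduct.map (TensorProduct.lift act) (LinearMap.mul' k H) ∘ₗ
            (TensorProduct.tensorTensorTensorComm k H H A H).toLinearMap) ∘ₗ
        (TensorProduct.assoc k A (H ⊗[k] H) (A ⊗[k] H)).toLinearMap ∘ₗ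
        (TensorProduct.mk k (A ⊗[k] (H ⊗[k] H)) (A ⊗[k] H)).flip (y ⊗ₜ g) ∘ₗ
        TensorProduct.mk k A (H ⊗[k] H) x =
      LinearMap.mulLeft k (inclA k A H x) ∘ₗ LinearMap.mulRight k (inclH k A H g) ∘ₗ
        LinearMap.mul' k (A ⊗[k] H) ∘ₗ
        TensorProduct.map (inclA k A H ∘ₗ act.flip y) (inclH k A H) := by
    ext a b
    simp
  exact LinearMap.congr_fun key (WH.comul h)

theorem smashMul_inclA_mul (x : A) (r s : A ⊗[k] H) :
    smashMul k WH act ((inclA k A H x * r) ⊗ₜ s) =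
      inclA k A H x * smashMul k WH act (r ⊗ₜ s) := by
  induction r using TensorProduct.induction_on with
  | zero => simp
  | tmul a h =>
    induction s using TensorProduct.induction_on with
    | zero => simp
    | tmul b g =>
      rw [LinearMap.flip_apply, TensorProduct.mk_apply, Algebra.TensorProduct.tmul_mul_tmul,
        one_mul, smashMul_tmul, smashMul_tmul, inclA_mul, mul_assoc]
      rfl
    | add s t hs ht => simp only [TensorProduct.tmul_add, map_add, mul_add, hs, ht]
  | add s t hs ht => simp only [TensorProduct.add_tmul, map_add, mul_add, hs, ht]

/-- Left `A`-linear maps commute with convolution by an `A`-valued map. -/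
theorem map_conv_inclA (φ : A ⊗[k] H →ₗ[k] A ⊗[k] H)
    (hφ : ∀ x r, φ (inclA k A H x * r) = inclA k A H x * φ r)
    (f : H →ₗ[k] A) (F : H →ₗ[k] A ⊗[k] H) (h : H) :
    φ (WH.conv (inclA k A H ∘ₗ f) F h) = WH.conv (inclA k A H ∘ₗ f) (φ ∘ₗ F) h := by
  simp only [WeakBialgebra.conv_apply]
  generalize WH.comul h = t
  induction t using TensorProduct.induction_on with
  | zero => simp
  | tmul a b =>
    simp only [TensorProduct.map_tmul, LinearMap.mul'_apply, LinearMap.comp_apply, hφ]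
  | add s t hs ht => simp only [map_add, hs, ht]

theorem projUnder_inclA_mul (x : A) (r : A ⊗[k] H) :
    projUnder k WH act (inclA k A H x * r) = inclA k A H x * projUnder k WH act r :=
  smashMul_inclA_mul x r _

theorem projUnder_tmul (x : A) (h : H) :
    projUnder k WH act (x ⊗ₜ h) =
      inclA k A H x * WH.conv (inclA k A H ∘ₗ act.flip 1) (inclH k A H) h := by
  have := smashMul_tmul (WH := WH) (act := act) x 1 h 1
  rw [show inclH k A H 1 = 1 from rfl, mul_one] at this
  exact this

theorem projBar_tmul (hc : ∀ a b : A, a * b = b * a) (x : A) (h : H) :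
    projBar k WH WA coact (x ⊗ₜ h) = inclA k A H x * twist WA coact h := by
  have h₀ : (TensorProduct.rid k (A ⊗[k] H)).toLinearMap ∘ₗ
        LinearMap.lTensor (A ⊗[k] H) (smashCounit k WH WA) ∘ₗ
        (TensorProduct.assoc k (A ⊗[k] H) A H).toLinearMap ∘ₗ
        LinearMap.rTensor H (LinearMap.lTensor (A ⊗[k] H) (LinearMap.mul' k A)) ∘ₗ
        LinearMap.rTensor H (TensorProduct.tensorTensorTensorComm k A A H A).toLinearMap ∘ₗ
        (TensorProduct.assoc k (A ⊗[k] A) (H ⊗[k] A) H).symm.toLinearMap =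
      (TensorProduct.rid k (A ⊗[k] H)).toLinearMap ∘ₗ
        LinearMap.lTensor (A ⊗[k] H) (WA.counit ∘ₗ LinearMap.mul' k A) ∘ₗ
        (TensorProduct.tensorTensorTensorComm k A A H A).toLinearMap ∘ₗ
        LinearMap.lTensor (A ⊗[k] A)
          ((TensorProduct.rid k (H ⊗[k] A)).toLinearMap ∘ₗ
            LinearMap.lTensor (H ⊗[k] A) WH.counit) := by
    ext a b l c q
    simp [smashCounit, TensorProduct.tmul_smul, smul_smul, mul_comm]
  have h₁ : ∀ s : H ⊗[k] H,
      TensorProduct.rid k (H ⊗[k] A) (LinearMap.lTensor (H ⊗[k] A) WH.counit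
        (LinearMap.rTensor H coact s)) =
      coact (TensorProduct.rid k H (LinearMap.lTensor H WH.counit s)) := fun s ↦ by
    induction s using TensorProduct.induction_on with
    | zero => simp
    | tmul p q => simp
    | add s t hs ht => simp only [map_add, hs, ht]
  have h₂ : ∀ u : H ⊗[k] A, TensorProduct.rid k (A ⊗[k] H)
        (LinearMap.lTensor (A ⊗[k] H) (WA.counit ∘ₗ LinearMap.mul' k A)
          (TensorProduct.tensorTensorTensorComm k A A H A (WA.comul x ⊗ₜ u))) =
      inclA k A H x * TensorProduct.comm k H A (LinearMap.lTensor H WA.εs u) := by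
    intro u
    induction u using TensorProduct.induction_on with
    | zero => simp
    | tmul l c =>
      simp only [LinearMap.lTensor_tmul, TensorProduct.comm_tmul, LinearMap.flip_apply,
        TensorProduct.mk_apply, Algebra.TensorProduct.tmul_mul_tmul, one_mul]
      rw [← WeakBialgebra.contract_comul hc]
      generalize WA.comul x = t
      induction t using TensorProduct.induction_on with
      | zero => simp
      | tmul a b => simp [TensorProduct.smul_tmul', hc b c]
      | add s t hs ht => simp only [TensorProduct.add_tmul, map_add, hs, ht]
    | add s t hs ht => simp only [TensorProduct.tmul_add, map_add, mul_add, hs, ht]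
  refine (LinearMap.congr_fun h₀ (WA.comul x ⊗ₜ LinearMap.rTensor H coact (WH.comul h))).trans ?_
  simp only [LinearMap.comp_apply, LinearMap.lTensor_tmul, LinearEquiv.coe_coe, h₁,
    WH.comul_counit, h₂]
  rfl

theorem projBar_inclA_mul (hc : ∀ a b : A, a * b = b * a) (x : A) (r : A ⊗[k] H) :
    projBar k WH WA coact (inclA k A H x * r) = inclA k A H x * projBar k WH WA coact r := by
  induction r using TensorProduct.induction_on with
  | zero => simp
  | tmul a h =>
    rw [LinearMap.flip_apply, TensorProduct.mk_apply, Algebra.TensorProduct.tmul_mul_tmul,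
      one_mul, projBar_tmul hc, projBar_tmul hc, inclA_mul, mul_assoc]
    rfl
  | add s t hs ht => simp only [map_add, mul_add, hs, ht]

theorem projBoth_tmul (hc : ∀ a b : A, a * b = b * a) (x : A) (h : H) :
    projBoth k WH WA act coact (x ⊗ₜ h) =
      inclA k A H x * WH.conv (inclA k A H ∘ₗ act.flip 1) (twist WA coact) h := by
  have hj : projBar k WH WA coact ∘ₗ inclH k A H = twist WA coact := by
    ext g
    simp only [LinearMap.comp_apply, TensorProduct.mk_apply, projBar_tmul hc]
    exact one_mul _
  rw [projBoth, LinearMap.comp_apply, projUnder_tmul, projBar_inclA_mul hc,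
    map_conv_inclA _ (projBar_inclA_mul hc), hj]

end WeakSmash

namespace WeakSmash

variable {k A H : Type*} [Field k] [Ring H] [Algebra k H] [Ring A] [Algebra k A]
  {WH : WeakBialgebra k H} {WA : WeakBialgebra k A}
  {act : H →ₗ[k] A →ₗ[k] A} {coact : H →ₗ[k] H ⊗[k] A}

theorem IsModuleAlgebra.conv_act (hM : IsModuleAlgebra k WH act) (a b : A) :
    WH.conv (act.flip a) (act.flip b) = act.flip (a * b) := by
  ext h
  exact (hM.act_mul h a b).symm

namespace IsCompatiblePair

theorem act_εs (hCP : IsCompatiblePair k WH WA act coact)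
    (h : H) (y : A) : act h (WA.εs y) = act h 1 * WA.εs y := by
  have h₁ : ∀ t : A ⊗[k] A, WA.contract y (TensorProduct.map (act h) (act 1) t) =
      act h (WA.contract y t) := fun t ↦ by
    induction t using TensorProduct.induction_on with
    | zero => simp
    | tmul a b => simp [hCP.pair.moduleAlgebra.one_act]
    | add s t hs ht => simp only [map_add, hs, ht]
  have h₂ : ∀ t : A ⊗[k] A, WA.contract y (TensorProduct.map
      (LinearMap.mulLeft k (act h 1)) (LinearMap.mulLeft k (act 1 1)) t) =
        act h 1 * WA.contract y t := fun t ↦ by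
    induction t using TensorProduct.induction_on with
    | zero => simp
    | tmul a b => simp [hCP.pair.moduleAlgebra.one_act]
    | add s t hs ht => simp only [map_add, mul_add, hs, ht]
  rw [WA.εs_eq_contract, ← h₁, hCP.compat2, h₂]

theorem act_mul_εs (hCP : IsCompatiblePair k WH WA act coact)
    (h : H) (w y : A) : act h (w * WA.εs y) = act h w * WA.εs y := by
  have h₁ : act.flip (WA.εs y) = LinearMap.mulRight k (WA.εs y) ∘ₗ act.flip 1 := by
    ext g
    simp [hCP.act_εs]
  have h₂ := hCP.pair.moduleAlgebra.conv_act w (WA.εs y)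
  rw [h₁, WeakBialgebra.conv_mulRight, hCP.pair.moduleAlgebra.conv_act, mul_one] at h₂
  exact (LinearMap.congr_fun h₂ h).symm

theorem conv_act_one_εs (hCP : IsCompatiblePair k WH WA act coact) :
    WH.conv (act.flip 1) (WA.εs ∘ₗ act.flip 1) = act.flip 1 := by
  ext h
  have h₁ : ∀ (a b : H) (t : A ⊗[k] A), TensorProduct.rid k A
      (TensorProduct.map (TensorProduct.lift act) (WA.counit ∘ₗ TensorProduct.lift act)
        (TensorProduct.tensorTensorTensorComm k H H A A ((a ⊗ₜ b) ⊗ₜ t))) =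
      WA.contract 1 (TensorProduct.map (act a) (act b) t) := fun a b t ↦ by
    induction t using TensorProduct.induction_on with
    | zero => simp
    | tmul c d => simp
    | add s t hs ht => simp only [TensorProduct.tmul_add, map_add, hs, ht]
  have h₂ : ∀ (c d : A) (t : A ⊗[k] A), WA.contract 1
      (TensorProduct.map (LinearMap.mulLeft k c) (LinearMap.mulLeft k d) t) =
        c * WA.contract d t := fun c d t ↦ by
    induction t using TensorProduct.induction_on with
    | zero => simp
    | tmul a b => simp
    | add s t hs ht => simp only [map_add, mul_add, hs, ht]
  rw [LinearMap.flip_apply, hCP.compat1, WeakBialgebra.conv_apply]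
  generalize WH.comul h = s
  induction s using TensorProduct.induction_on with
  | zero => simp
  | tmul a b =>
    rw [h₁, hCP.compat2, h₂, ← WA.εs_eq_contract]
    simp
  | add s t hs ht => simp only [TensorProduct.add_tmul, map_add, hs, ht]

theorem conv_εs_act_one (hCP : IsCompatiblePair k WH WA act coact) :
    WH.conv (WA.εs ∘ₗ act.flip 1) (WA.εs ∘ₗ act.flip 1) = WA.εs ∘ₗ act.flip 1 := by
  rw [← WeakBialgebra.comp_conv _ _ (WeakBialgebra.εs_mul hCP.comm),
    hCP.pair.moduleAlgebra.conv_act, mul_one]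

/-- The contraction `(a ⊗ h) ⊗ c ↦ a εs(c) ⊗ h` used to read off information from the matched
pair condition. -/
theorem exists_contraction (hCP : IsCompatiblePair k WH WA act coact) :
    ∃ Θ : (A ⊗[k] H) ⊗[k] A →ₗ[k] A ⊗[k] H,
    ∀ (s : A ⊗[k] A) (t : H ⊗[k] A),
      Θ (LinearMap.lTensor (A ⊗[k] H) (LinearMap.mul' k A)
        (TensorProduct.tensorTensorTensorComm k A A H A (s ⊗ₜ t))) =
      inclA k A H (LinearMap.mul' k A (LinearMap.lTensor A WA.εs s)) *
        TensorProduct.comm k H A (LinearMap.lTensor H WA.εs t) := by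
  refine ⟨LinearMap.rTensor H (LinearMap.mul' k A ∘ₗ LinearMap.lTensor A WA.εs) ∘ₗ
    (TensorProduct.assoc k A A H).symm.toLinearMap ∘ₗ
    LinearMap.lTensor A (TensorProduct.comm k H A).toLinearMap ∘ₗ
    (TensorProduct.assoc k A H A).toLinearMap, fun s t ↦ ?_⟩
  induction s using TensorProduct.induction_on with
  | zero => simp
  | tmul a b =>
    induction t using TensorProduct.induction_on with
    | zero => simp
    | tmul l c => simp [WeakBialgebra.εs_mul hCP.comm, mul_assoc]
    | add s t hs ht => simp only [TensorProduct.tmul_add, map_add, mul_add, hs, ht]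
  | add s t hs ht => simp only [TensorProduct.add_tmul, map_add, add_mul, hs, ht]

theorem mul_εs_pairMapA (hCP : IsCompatiblePair k WH WA act coact) (a b : H) (x : A) :
    LinearMap.mul' k A (LinearMap.lTensor A WA.εs
      (pairMapA k act coact ((a ⊗ₜ b) ⊗ₜ WA.comul x))) =
      twistAct WA act coact x a * WA.εs (act b 1) := by
  have key : ∀ (u : H ⊗[k] A) (s : A ⊗[k] A),
      LinearMap.mul' k A (LinearMap.lTensor A WA.εs
        (LinearMap.lTensor A (LinearMap.mul' k A) (TensorProduct.assoc k A A A
          (LinearMap.rTensor A (LinearMap.rTensor A (TensorProduct.lift act) ∘ₗ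
            (TensorProduct.assoc k H A A).symm.toLinearMap ∘ₗ
            LinearMap.lTensor H (TensorProduct.comm k A A).toLinearMap ∘ₗ
            (TensorProduct.assoc k H A A).toLinearMap)
            (TensorProduct.map (TensorProduct.mk k (H ⊗[k] A) A u) (act b) s))))) =
      LinearMap.mul' k A (TensorProduct.map
        (act.flip (LinearMap.mul' k A (LinearMap.lTensor A WA.εs s))) WA.εs u) *
          WA.εs (act b 1) := fun u s ↦ by
    induction u using TensorProduct.induction_on with
    | zero =>
      induction s using TensorProduct.induction_on with
      | zero => simp
      | tmul c d => simp
      | add s t hs ht => simp_all only [map_add, map_zero, zero_mul, add_zero]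
    | tmul l c =>
      induction s using TensorProduct.induction_on with
      | zero => simp
      | tmul x₁ x₂ =>
        simp only [TensorProduct.map_tmul, TensorProduct.mk_apply, LinearMap.rTensor_tmul,
          LinearMap.comp_apply, LinearEquiv.coe_coe, TensorProduct.assoc_tmul,
          LinearMap.lTensor_tmul, TensorProduct.comm_tmul, TensorProduct.assoc_symm_tmul,
          TensorProduct.lift.tmul, LinearMap.mul'_apply, LinearMap.flip_apply,
          hCP.act_mul_εs, WeakBialgebra.εs_mul hCP.comm, hCP.pair.cond4 b x₂]
        rw [hCP.comm (WA.εs (act b 1)), mul_assoc, mul_assoc, ← mul_assoc (WA.εs c),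
          hCP.comm (WA.εs c), mul_assoc]
      | add s t hs ht =>
        simp only [map_add, add_mul, hs, ht, TensorProduct.map_add_left, LinearMap.add_apply]
    | add u v hu hv =>
      simp only [map_add, add_mul, ← hu, ← hv, TensorProduct.map_add_left, LinearMap.add_apply]
  have hs : ∀ s : A ⊗[k] A, TensorProduct.map (LinearMap.rTensor A coact) (TensorProduct.lift act)
      (TensorProduct.tensorTensorTensorComm k H H A A ((a ⊗ₜ b) ⊗ₜ s)) =
      TensorProduct.map (TensorProduct.mk k (H ⊗[k] A) A (coact a)) (act b) s := fun s ↦ by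
    induction s using TensorProduct.induction_on with
    | zero => simp
    | tmul c d => simp
    | add s t hs ht => simp only [TensorProduct.tmul_add, map_add, hs, ht]
  have := key (coact a) (WA.comul x)
  rw [← hs, WA.mul_εs_comul] at this
  exact this

theorem comm_εs_pairMapH (hCP : IsCompatiblePair k WH WA act coact) (a b : H) (t : H ⊗[k] A) :
    TensorProduct.comm k H A (LinearMap.lTensor H WA.εs
      (pairMapH k act coact ((a ⊗ₜ b) ⊗ₜ t))) =
      twist WA coact a * (inclA k A H (WA.εs (act b 1)) *
        TensorProduct.comm k H A (LinearMap.lTensor H WA.εs t)) := by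
  induction t using TensorProduct.induction_on with
  | zero => simp
  | tmul g c =>
    simp only [pairMapH, twist, LinearMap.comp_apply, LinearEquiv.coe_coe,
      TensorProduct.tensorTensorTensorComm_tmul, TensorProduct.map_tmul, LinearMap.rTensor_tmul,
      TensorProduct.lift.tmul]
    generalize coact a = u
    induction u using TensorProduct.induction_on with
    | zero => simp
    | tmul l d =>
      simp [WeakBialgebra.εs_mul hCP.comm, hCP.pair.cond4 b c]
    | add s t hs ht => simp only [TensorProduct.add_tmul, map_add, add_mul, hs, ht]
  | add s t hs ht => simp only [TensorProduct.tmul_add, map_add, mul_add, hs, ht]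

end IsCompatiblePair

end WeakSmash

namespace WeakSmash

variable {k A H : Type*} [Field k] [Ring H] [Algebra k H] [Ring A] [Algebra k A]
  {WH : WeakBialgebra k H} {WA : WeakBialgebra k A}
  {act : H →ₗ[k] A →ₗ[k] A} {coact : H →ₗ[k] H ⊗[k] A}

theorem mul_map_threeComul {R : Type*} [Ring R] [Algebra k R] (f₁ f₂ f₃ f₄ : H →ₗ[k] R) (h : H) :
    LinearMap.mul' k R (TensorProduct.map (LinearMap.mul' k R ∘ₗ TensorProduct.map f₁ f₂)
      (LinearMap.mul' k R ∘ₗ TensorProduct.map f₃ f₄)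
      ((TensorProduct.assoc k H H (H ⊗[k] H)).symm (threeComul k WH h))) =
      WH.conv f₁ (WH.conv f₂ (WH.conv f₃ f₄)) h := by
  have h₁ : LinearMap.mul' k R ∘ₗ TensorProduct.map (LinearMap.mul' k R ∘ₗ TensorProduct.map f₁ f₂)
        (LinearMap.mul' k R ∘ₗ TensorProduct.map f₃ f₄) ∘ₗ
        (TensorProduct.assoc k H H (H ⊗[k] H)).symm.toLinearMap =
      LinearMap.mul' k R ∘ₗ TensorProduct.map f₁ (LinearMap.mul' k R ∘ₗ TensorProduct.map f₂
        (LinearMap.mul' k R ∘ₗ TensorProduct.map f₃ f₄)) := by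
    ext a b c d
    simp [mul_assoc]
  refine (LinearMap.congr_fun h₁ (threeComul k WH h)).trans ?_
  simp only [threeComul, WeakBialgebra.conv, LinearMap.lTensor, LinearMap.comp_apply,
    TensorProduct.map_map, LinearMap.comp_assoc, LinearMap.comp_id]
  rw [← LinearMap.comp_assoc WH.comul (TensorProduct.map LinearMap.id WH.comul),
    ← TensorProduct.map_comp, LinearMap.comp_id, LinearMap.comp_assoc]

namespace IsCompatiblePair

theorem conv_act_twist_mulRight (hCP : IsCompatiblePair k WH WA act coact) (g : H) (x : A) :
    WH.conv (inclA k A H ∘ₗ act.flip x) (twist WA coact ∘ₗ LinearMap.mulRight k g) =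
      WH.conv (inclA k A H ∘ₗ twistAct WA act coact x)
        (WH.conv (inclA k A H ∘ₗ WA.εs ∘ₗ act.flip 1)
          (LinearMap.mulRight k (twist WA coact g) ∘ₗ twist WA coact)) := by
  obtain ⟨Θ, hΘ⟩ := hCP.exists_contraction
  have h₁ : ∀ u : H ⊗[k] H, Θ (LinearMap.lTensor (A ⊗[k] H) (LinearMap.mul' k A)
      (TensorProduct.tensorTensorTensorComm k A A H A
        (TensorProduct.map (WA.comul ∘ₗ act.flip x) (coact ∘ₗ LinearMap.mulRight k g) u))) =
      LinearMap.mul' k (A ⊗[k] H) (TensorProduct.map (inclA k A H ∘ₗ act.flip x)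
        (twist WA coact ∘ₗ LinearMap.mulRight k g) u) := fun u ↦ by
    induction u using TensorProduct.induction_on with
    | zero => simp
    | tmul a b =>
      rw [TensorProduct.map_tmul, hΘ, LinearMap.comp_apply, WA.mul_εs_comul]
      rfl
    | add s t hs ht => simp only [map_add, hs, ht]
  have h₂ : ∀ q : (H ⊗[k] H) ⊗[k] (H ⊗[k] H),
      Θ (LinearMap.lTensor (A ⊗[k] H) (LinearMap.mul' k A)
        (TensorProduct.tensorTensorTensorComm k A A H A
          (TensorProduct.map
            (pairMapA k act coact ∘ₗ
              (TensorProduct.mk k (H ⊗[k] H) (A ⊗[k] A)).flip (WA.comul x))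
            (pairMapH k act coact ∘ₗ
              (TensorProduct.mk k (H ⊗[k] H) (H ⊗[k] A)).flip (coact g)) q))) =
      LinearMap.mul' k (A ⊗[k] H) (TensorProduct.map
        (LinearMap.mul' k (A ⊗[k] H) ∘ₗ TensorProduct.map
          (inclA k A H ∘ₗ twistAct WA act coact x) (inclA k A H ∘ₗ WA.εs ∘ₗ act.flip 1))
        (LinearMap.mul' k (A ⊗[k] H) ∘ₗ TensorProduct.map (twist WA coact)
          (LinearMap.mulRight k (twist WA coact g) ∘ₗ inclA k A H ∘ₗ WA.εs ∘ₗ act.flip 1))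
          q) := fun q ↦ by
    induction q using TensorProduct.induction_on with
    | zero => simp
    | tmul s t =>
      induction s using TensorProduct.induction_on with
      | zero => simp
      | tmul a b =>
        induction t using TensorProduct.induction_on with
        | zero => simp
        | tmul c d =>
          rw [TensorProduct.map_tmul, hΘ, LinearMap.comp_apply, LinearMap.comp_apply]
          refine (congrArg₂ _ (congrArg _ (hCP.mul_εs_pairMapA a b x))
            (hCP.comm_εs_pairMapH c d (coact g))).trans ?_
          rw [inclA_mul]
          rfl
        | add s t hs ht => simp only [TensorProduct.tmul_add, map_add, hs, ht]
      | add s t hs ht => simp only [TensorProduct.add_tmul, map_add, hs, ht]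
    | add s t hs ht => simp only [map_add, hs, ht]
  have h₃ : WH.conv (inclA k A H ∘ₗ act.flip x) (twist WA coact ∘ₗ LinearMap.mulRight k g) =
      WH.conv (inclA k A H ∘ₗ twistAct WA act coact x)
        (WH.conv (inclA k A H ∘ₗ WA.εs ∘ₗ act.flip 1) (WH.conv (twist WA coact)
          (LinearMap.mulRight k (twist WA coact g) ∘ₗ inclA k A H ∘ₗ WA.εs ∘ₗ act.flip 1))) := by
    ext1 h
    rw [← mul_map_threeComul, ← h₂, WeakBialgebra.conv_apply, ← h₁]
    exact congrArg Θ (hCP.pair.cond3 h g x)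
  rw [h₃, WeakBialgebra.conv_mulRight, WeakBialgebra.conv_comm hCP.cocomm
    (f := twist WA coact) fun a b ↦ (inclA_mul_comm hCP.comm _ _).symm,
    ← WeakBialgebra.conv_mulRight, conv_inclA_conv (WA.εs ∘ₗ act.flip 1),
    hCP.conv_εs_act_one]

theorem conv_act_one_conv (hCP : IsCompatiblePair k WH WA act coact)
    (w : A) (F : H →ₗ[k] A ⊗[k] H) :
    WH.conv (inclA k A H ∘ₗ act.flip 1) (WH.conv (inclA k A H ∘ₗ act.flip w) F) =
      WH.conv (inclA k A H ∘ₗ act.flip w) F := by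
  rw [conv_inclA_conv, hCP.pair.moduleAlgebra.conv_act, one_mul]

theorem conv_act_twist_mul (hCP : IsCompatiblePair k WH WA act coact) (g : H) (w : A) :
    WH.conv (inclA k A H ∘ₗ act.flip w) (twist WA coact ∘ₗ LinearMap.mulRight k g) =
      WH.conv (inclA k A H ∘ₗ act.flip 1) (LinearMap.mulRight k (twist WA coact g) ∘ₗ
        WH.conv (inclA k A H ∘ₗ twistAct WA act coact w) (twist WA coact)) := by
  rw [← hCP.conv_act_one_conv, hCP.conv_act_twist_mulRight,
    conv_inclA_conv (twistAct WA act coact w),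
    WeakBialgebra.conv_comm hCP.cocomm fun a b ↦ hCP.comm _ _,
    ← conv_inclA_conv, conv_inclA_conv (act.flip 1), hCP.conv_act_one_εs, WeakBialgebra.conv_mulRight]

theorem conv_act_mul_εs (hCP : IsCompatiblePair k WH WA act coact) (w c : A) (l : H) :
    WH.conv (inclA k A H ∘ₗ act.flip (w * WA.εs c)) (inclH k A H) l =
      WH.conv (inclA k A H ∘ₗ act.flip w) (inclH k A H) l * inclA k A H (WA.εs c) := by
  rw [conv_inclA_inclH, conv_inclA_inclH]
  generalize WH.comul l = t
  induction t using TensorProduct.induction_on with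
  | zero => simp
  | tmul a b => simp [hCP.act_mul_εs]
  | add s t hs ht => simp only [map_add, add_mul, hs, ht]

theorem smashMul_twist (hCP : IsCompatiblePair k WH WA act coact) (ζ w : A) (l : H)
    (t : H ⊗[k] A) :
    smashMul k WH act ((ζ ⊗ₜ l) ⊗ₜ (inclA k A H w *
      TensorProduct.comm k H A (LinearMap.lTensor H WA.εs t))) =
      inclA k A H ζ * (WH.conv (inclA k A H ∘ₗ act.flip w) (inclH k A H) l *
        TensorProduct.comm k H A (LinearMap.lTensor H WA.εs t)) := by
  induction t using TensorProduct.induction_on with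
  | zero => simp
  | tmul g c =>
    have h₁ : inclA k A H w * TensorProduct.comm k H A (LinearMap.lTensor H WA.εs (g ⊗ₜ c)) =
      (w * WA.εs c) ⊗ₜ g := by simp
    rw [h₁, smashMul_tmul, hCP.conv_act_mul_εs, mul_assoc (WH.conv _ _ _)]
    simp
  | add s t hs ht => simp only [TensorProduct.tmul_add, map_add, mul_add, hs, ht]

theorem smashMul_twist_twist (hCP : IsCompatiblePair k WH WA act coact) (h g : H) (w : A) :
    smashMul k WH act (twist WA coact h ⊗ₜ (inclA k A H w * twist WA coact g)) =
      WH.conv (inclA k A H ∘ₗ twistAct WA act coact w) (twist WA coact) h *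
        twist WA coact g := by
  let Ψ : (H ⊗[k] H) ⊗[k] A →ₗ[k] A ⊗[k] H :=
    LinearMap.mul' k (A ⊗[k] H) ∘ₗ (TensorProduct.comm k (A ⊗[k] H) (A ⊗[k] H)).toLinearMap ∘ₗ
      TensorProduct.map (LinearMap.rTensor H (act.flip w)) (inclA k A H ∘ₗ WA.εs)
  have h₁ : ∀ u : H ⊗[k] A, smashMul k WH act
      (TensorProduct.comm k H A (LinearMap.lTensor H WA.εs u) ⊗ₜ
        (inclA k A H w * twist WA coact g)) =
      Ψ (LinearMap.rTensor A WH.comul u) * twist WA coact g := fun u ↦ by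
    induction u using TensorProduct.induction_on with
    | zero => simp
    | tmul l c =>
      refine (hCP.smashMul_twist (WA.εs c) w l (coact g)).trans ?_
      rw [← mul_assoc, conv_inclA_inclH]
      rfl
    | add s t hs ht => simp only [TensorProduct.add_tmul, map_add, add_mul, hs, ht]
  have h₂ : ∀ s t : H ⊗[k] A, Ψ (LinearMap.lTensor (H ⊗[k] H) (LinearMap.mul' k A)
      (TensorProduct.tensorTensorTensorComm k H A H A (s ⊗ₜ t))) =
      inclA k A H (LinearMap.mul' k A (TensorProduct.map (act.flip w) WA.εs s)) *
        TensorProduct.comm k H A (LinearMap.lTensor H WA.εs t) := fun s t ↦ by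
    induction s using TensorProduct.induction_on with
    | zero => simp
    | tmul a b =>
      induction t using TensorProduct.induction_on with
      | zero => simp
      | tmul l c =>
        simp [Ψ, WeakBialgebra.εs_mul hCP.comm, mul_assoc, hCP.comm _ (act a w)]
      | add s t hs ht => simp only [TensorProduct.tmul_add, map_add, mul_add, hs, ht]
    | add s t hs ht => simp only [TensorProduct.add_tmul, map_add, add_mul, hs, ht]
  have h₃ : ∀ q : H ⊗[k] H, Ψ (LinearMap.lTensor (H ⊗[k] H) (LinearMap.mul' k A)
      (TensorProduct.tensorTensorTensorComm k H A H A (TensorProduct.map coact coact q))) =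
      LinearMap.mul' k (A ⊗[k] H) (TensorProduct.map
        (inclA k A H ∘ₗ twistAct WA act coact w) (twist WA coact) q) := fun q ↦ by
    induction q using TensorProduct.induction_on with
    | zero => simp
    | tmul a b => exact h₂ (coact a) (coact b)
    | add s t hs ht => simp only [map_add, hs, ht]
  refine (h₁ (coact h)).trans ?_
  rw [hCP.pair.comoduleCoalgebra.comul_coact, h₃, ← WeakBialgebra.conv_apply]

theorem smashMul_projBoth_projBar (hCP : IsCompatiblePair k WH WA act coact) (u v : A ⊗[k] H) :
    smashMul k WH act (projBoth k WH WA act coact u ⊗ₜ projBar k WH WA coact v) =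
      projBar k WH WA coact (smashMul k WH act (u ⊗ₜ v)) := by
  induction u using TensorProduct.induction_on with
  | zero => simp
  | tmul x h =>
    induction v using TensorProduct.induction_on with
    | zero => simp
    | tmul w g =>
      rw [projBoth_tmul hCP.comm, projBar_tmul hCP.comm, smashMul_inclA_mul, smashMul_tmul,
        projBar_inclA_mul hCP.comm]
      congr 1
      have h₁ := map_conv_inclA (WH := WH) (smashMul k WH act ∘ₗ
        (TensorProduct.mk k (A ⊗[k] H) (A ⊗[k] H)).flip (inclA k A H w * twist WA coact g))
        (fun x r ↦ smashMul_inclA_mul x r _) (act.flip 1) (twist WA coact) h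
      have h₂ : (smashMul k WH act ∘ₗ (TensorProduct.mk k (A ⊗[k] H) (A ⊗[k] H)).flip
          (inclA k A H w * twist WA coact g)) ∘ₗ twist WA coact =
          LinearMap.mulRight k (twist WA coact g) ∘ₗ
            WH.conv (inclA k A H ∘ₗ twistAct WA act coact w) (twist WA coact) := by
        ext1 h
        exact hCP.smashMul_twist_twist h g w
      have h₃ := map_conv_inclA (WH := WH) (projBar k WH WA coact) (projBar_inclA_mul hCP.comm)
        (act.flip w) (LinearMap.mulRight k (inclH k A H g) ∘ₗ inclH k A H) h
      have h₄ : projBar k WH WA coact ∘ₗ LinearMap.mulRight k (inclH k A H g) ∘ₗ inclH k A H =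
          twist WA coact ∘ₗ LinearMap.mulRight k g := by
        ext l
        simp only [LinearMap.comp_apply, LinearMap.mulRight_apply, TensorProduct.mk_apply,
          Algebra.TensorProduct.tmul_mul_tmul, mul_one, projBar_tmul hCP.comm]
        exact one_mul _
      rw [h₂, ← hCP.conv_act_twist_mul] at h₁
      rw [h₄, WeakBialgebra.conv_mulRight] at h₃
      exact h₁.trans h₃.symm
    | add s t hs ht => simp only [TensorProduct.tmul_add, map_add, hs, ht]
  | add s t hs ht => simp only [TensorProduct.add_tmul, map_add, hs, ht]

theorem projUnder_projUnder (hCP : IsCompatiblePair k WH WA act coact) (u : A ⊗[k] H) :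
    projUnder k WH act (projUnder k WH act u) = projUnder k WH act u := by
  induction u using TensorProduct.induction_on with
  | zero => simp
  | tmul x h =>
    have h₁ : projUnder k WH act ∘ₗ inclH k A H =
        WH.conv (inclA k A H ∘ₗ act.flip 1) (inclH k A H) := by
      ext1 h
      exact (projUnder_tmul 1 h).trans (one_mul _)
    rw [projUnder_tmul, projUnder_inclA_mul, map_conv_inclA _ projUnder_inclA_mul, h₁,
      hCP.conv_act_one_conv]
  | add s t hs ht => simp only [map_add, hs, ht]

theorem rTensor_act_comul_mul (hCP : IsCompatiblePair k WH WA act coact) (l p q : H) :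
    LinearMap.rTensor H (act.flip 1) (WH.comul l * (p ⊗ₜ q)) =
      WH.conv (inclA k A H ∘ₗ act.flip (act p 1)) (inclH k A H) l * inclH k A H q := by
  rw [conv_inclA_inclH]
  generalize WH.comul l = t
  induction t using TensorProduct.induction_on with
  | zero => simp
  | tmul a b => simp [hCP.pair.moduleAlgebra.act_act]
  | add s t hs ht => simp only [map_add, add_mul, hs, ht]

theorem smashMul_rTensor_act (hCP : IsCompatiblePair k WH WA act coact)
    (x y : A) (h : H) (t : H ⊗[k] H) :
    smashMul k WH act ((x ⊗ₜ h) ⊗ₜ (inclA k A H y * LinearMap.rTensor H (act.flip 1) t)) =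
      inclA k A H x * WH.conv (inclA k A H ∘ₗ act.flip y)
        (LinearMap.rTensor H (act.flip 1) ∘ₗ LinearMap.mulRight k t ∘ₗ WH.comul) h := by
  induction t using TensorProduct.induction_on with
  | zero => simp [WeakBialgebra.conv_apply]
  | tmul p q =>
    have h₁ : LinearMap.rTensor H (act.flip 1) ∘ₗ LinearMap.mulRight k (p ⊗ₜ q) ∘ₗ WH.comul =
        LinearMap.mulRight k (inclH k A H q) ∘ₗ
          WH.conv (inclA k A H ∘ₗ act.flip (act p 1)) (inclH k A H) := by
      ext1 l
      exact hCP.rTensor_act_comul_mul l p q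
    have h₂ : inclA k A H y * LinearMap.rTensor H (act.flip 1) (p ⊗ₜ[k] q) =
        (y * act p 1) ⊗ₜ q := by simp
    rw [h₁, h₂, smashMul_tmul, WeakBialgebra.conv_mulRight, conv_inclA_conv,
      hCP.pair.moduleAlgebra.conv_act]
    rfl
  | add s t hs ht =>
    have h₁ : LinearMap.mulRight k (s + t) = LinearMap.mulRight k s + LinearMap.mulRight k t :=
      LinearMap.ext fun r ↦ mul_add r s t
    simp only [map_add, mul_add, TensorProduct.tmul_add, hs, ht, h₁, LinearMap.add_comp,
      LinearMap.comp_add, WeakBialgebra.conv_apply, TensorProduct.map_add_right,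
      LinearMap.add_apply]

theorem projUnder_smashMul (hCP : IsCompatiblePair k WH WA act coact) (u v : A ⊗[k] H) :
    projUnder k WH act (smashMul k WH act (u ⊗ₜ v)) =
      smashMul k WH act (u ⊗ₜ projUnder k WH act v) := by
  induction u using TensorProduct.induction_on with
  | zero => simp
  | tmul x h =>
    induction v using TensorProduct.induction_on with
    | zero => simp
    | tmul y g =>
      have h₁ : projUnder k WH act ∘ₗ LinearMap.mulRight k (inclH k A H g) ∘ₗ inclH k A H =
          LinearMap.rTensor H (act.flip 1) ∘ₗ LinearMap.mulRight k (WH.comul g) ∘ₗ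
            WH.comul := by
        ext1 l
        simp only [LinearMap.comp_apply, LinearMap.mulRight_apply, TensorProduct.mk_apply,
          Algebra.TensorProduct.tmul_mul_tmul, mul_one]
        rw [projUnder_tmul, conv_inclA_inclH, WH.comul_mul]
        exact one_mul _
      have h₂ := map_conv_inclA (WH := WH) (projUnder k WH act) projUnder_inclA_mul
        (act.flip y) (LinearMap.mulRight k (inclH k A H g) ∘ₗ inclH k A H) h
      rw [h₁, WeakBialgebra.conv_mulRight] at h₂
      rw [projUnder_tmul, conv_inclA_inclH, hCP.smashMul_rTensor_act, smashMul_tmul,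
        projUnder_inclA_mul, ← h₂]
      rfl
    | add s t hs ht => simp only [TensorProduct.tmul_add, map_add, hs, ht]
  | add s t hs ht => simp only [TensorProduct.add_tmul, map_add, hs, ht]

theorem smashMul_projBoth (hCP : IsCompatiblePair k WH WA act coact) (u v : A ⊗[k] H) :
    smashMul k WH act (projBoth k WH WA act coact u ⊗ₜ projBoth k WH WA act coact v) =
      projBoth k WH WA act coact (smashMul k WH act (u ⊗ₜ v)) := by
  refine (hCP.smashMul_projBoth_projBar u (projUnder k WH act v)).trans ?_
  rw [← hCP.projUnder_smashMul]
  rfl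

theorem rTensor_act_comul_one (hCP : IsCompatiblePair k WH WA act coact) (v : A) :
    LinearMap.rTensor H (act.flip v) (WH.comul 1) =
      LinearMap.rTensor H (act.flip 1) (WH.comul 1) * inclA k A H v := by
  let Φ : H ⊗[k] (H ⊗[k] H) →ₗ[k] A ⊗[k] H :=
    LinearMap.rTensor H (LinearMap.mul' k A ∘ₗ TensorProduct.map (act.flip v) (act.flip 1)) ∘ₗ
      (TensorProduct.assoc k H H H).symm.toLinearMap
  have h₁ : ∀ s : H ⊗[k] H,
      Φ (TensorProduct.assoc k H H H (LinearMap.rTensor H WH.comul s)) =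
        LinearMap.rTensor H (act.flip v) s := fun s ↦ by
    induction s using TensorProduct.induction_on with
    | zero => simp
    | tmul a b =>
      have := hCP.pair.moduleAlgebra.act_mul a v 1
      rw [mul_one] at this
      simp [Φ, this]
    | add s t hs ht => simp only [map_add, hs, ht]
  have h₂ : ∀ t : H ⊗[k] H,
      Φ (TensorProduct.assoc k H H H (WH.comul 1 ⊗ₜ 1) * (1 ⊗ₜ t)) =
        LinearMap.rTensor H (act.flip 1) t * inclA k A H v := fun t ↦ by
    induction t using TensorProduct.induction_on with
    | zero => simp
    | tmul p q =>
      have h₃ : ∀ s : H ⊗[k] H,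
          Φ (TensorProduct.assoc k H H H (s ⊗ₜ 1) * (1 ⊗ₜ (p ⊗ₜ q))) =
            LinearMap.mul' k A (TensorProduct.map (act.flip v) (act.flip (act p 1)) s) ⊗ₜ q :=
        fun s ↦ by
        induction s using TensorProduct.induction_on with
        | zero => simp
        | tmul a b => simp [Φ, hCP.pair.moduleAlgebra.act_act]
        | add s t hs ht => simp only [TensorProduct.add_tmul, map_add, add_mul, hs, ht]
      rw [h₃, ← hCP.pair.moduleAlgebra.act_mul, hCP.pair.moduleAlgebra.one_act, hCP.comm]
      simp
    | add s t hs ht => simp only [TensorProduct.tmul_add, mul_add, map_add, add_mul, hs, ht]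
  rw [← h₁, WH.coassoc, ← WH.comul_one_left, h₂]

theorem smashMul_one_projUnder (hCP : IsCompatiblePair k WH WA act coact) (v : A ⊗[k] H) :
    smashMul k WH act ((1 ⊗ₜ 1) ⊗ₜ projUnder k WH act v) = projUnder k WH act v := by
  have h₁ : ∀ v : A ⊗[k] H, smashMul k WH act ((1 ⊗ₜ 1) ⊗ₜ v) =
      LinearMap.rTensor H (act.flip 1) (WH.comul 1) * v := fun v ↦ by
    induction v using TensorProduct.induction_on with
    | zero => simp
    | tmul y g =>
      rw [smashMul_tmul, conv_inclA_inclH, hCP.rTensor_act_comul_one, mul_assoc]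
      simp [← Algebra.TensorProduct.one_def]
    | add s t hs ht => simp only [TensorProduct.tmul_add, map_add, mul_add, hs, ht]
  have h₂ : ∀ t : H ⊗[k] H, LinearMap.rTensor H (act.flip 1) (WH.comul 1) *
      LinearMap.rTensor H (act.flip 1) t =
        LinearMap.rTensor H (act.flip 1) (WH.comul 1 * t) := fun t ↦ by
    induction t using TensorProduct.induction_on with
    | zero => simp
    | tmul p q =>
      rw [hCP.rTensor_act_comul_mul, conv_inclA_inclH, hCP.rTensor_act_comul_one (act p 1),
        mul_assoc]
      simp
    | add s t hs ht => simp only [map_add, mul_add, hs, ht]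
  induction v using TensorProduct.induction_on with
  | zero => simp
  | tmul y g =>
    rw [h₁, projUnder_tmul, conv_inclA_inclH, ← mul_assoc, ← inclA_mul_comm hCP.comm, mul_assoc,
      h₂, ← WH.comul_mul, one_mul]
  | add s t hs ht => simp only [TensorProduct.tmul_add, map_add, hs, ht]

end IsCompatiblePair

end WeakSmash

namespace WeakSmash

theorem both_algebra
    {k H A : Type*} [Field k] [Ring H] [Algebra k H] [Ring A] [Algebra k A]
    (WH : WeakBialgebra k H) (WA : WeakBialgebra k A)
    (act : H →ₗ[k] A →ₗ[k] A) (coact : H →ₗ[k] H ⊗[k] A)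
    (hCP : IsCompatiblePair k WH WA act coact) :
    (∀ (x y : A) (h g : H),
        smashMul k WH act
            (projBoth k WH WA act coact (x ⊗ₜ[k] h) ⊗ₜ[k]
              projBoth k WH WA act coact (y ⊗ₜ[k] g)) =
          projBoth k WH WA act coact
            (smashMul k WH act ((x ⊗ₜ[k] h) ⊗ₜ[k] (y ⊗ₜ[k] g)))) ∧
    (∀ u ∈ LinearMap.range (projBoth k WH WA act coact),
        smashMul k WH act (u ⊗ₜ[k] smashOne k WH WA act coact) = u ∧
        smashMul k WH act (smashOne k WH WA act coact ⊗ₜ[k] u) = u) := by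
  refine ⟨fun x y h g ↦ hCP.smashMul_projBoth _ _, ?_⟩
  rintro _ ⟨u, rfl⟩
  constructor
  · refine (hCP.smashMul_projBoth u (1 ⊗ₜ 1)).trans ?_
    exact congrArg (projBar k WH WA coact) (hCP.projUnder_projUnder u)
  · refine (hCP.smashMul_projBoth (1 ⊗ₜ 1) u).trans ?_
    exact congrArg (projBar k WH WA coact)
      ((hCP.projUnder_smashMul _ u).trans (hCP.smashMul_one_projUnder u))

end WeakSmash
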